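/- arXiv:2302.14615 — 2 statements merged into one kernel-verified Lean document; each statement's English description precedes it below -/
import Mathlib

section
/- Let A ∈ ℝ^{d1×d2} have nonzero rows, fix the worker/category data and P(t, ℓ, g | τ), g_0(t) as in the context, let 1 ≤ d0 ≤ d1, and let e_{t,ℓ} ∈ ℝ (0 ≤ ℓ ≤ k, e_{t,0} = 0). Then the expected squared adversarial error satisfies (1 / C(d1, d0)) · Σ_{τ ⊆ [d1], |τ| = d0} Σ_{t ∈ τ} Σ_{g=g_0(t)}^{n_t} Σ_{ℓ=0}^{k} P(t, ℓ, g | τ) · e_{t,ℓ}² / ‖A_t‖₂² ≤ (d0 / d1) · Σ_{t ∈ [d1]} ‖ẽ_t‖₂², where ‖ẽ_t‖₂² = Σ_{ℓ=0}^{k} e_{t,ℓ}² / ‖A_t‖₂². -/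
open Finset Polynomial

/-- `∑_{j=0}^{g−1} C(mc, j) x^j`. -/
noncomputable def catPoly (mc g : ℕ) : Polynomial ℕ :=
  ∑ j ∈ Finset.range g, Polynomial.C (mc.choose j) * Polynomial.X ^ j

/-- `a^t_{g,ℓ}`: coefficient of `x^{n−g}` in `∏_{ℓ'≠ℓ} (∑_{j=0}^{g−1} C(m ℓ', j) x^j)`. -/
noncomputable def aCoeff (k : ℕ) (m : Fin (k + 1) → ℕ) (n g : ℕ) (ℓ : Fin (k + 1)) : ℕ :=
  (∏ ℓ' ∈ Finset.univ.erase ℓ, catPoly (m ℓ') g).coeff (n - g)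

/-- `b^s_g`: coefficient of `x^n` in `∏_{ℓ=0}^{k} (∑_{j=0}^{g−1} C(m ℓ, j) x^j)`. -/
noncomputable def bCoeff (k : ℕ) (m : Fin (k + 1) → ℕ) (n g : ℕ) : ℕ :=
  (∏ ℓ : Fin (k + 1), catPoly (m ℓ) g).coeff n

/-- `P(t, ℓ, g | τ) = [C(m t ℓ, g)·a^t_{g,ℓ}/C(N t, n t)]·∏_{s∈τ\{t}} b^s_g/C(N s, n s)`. -/
noncomputable def Pfun {ι : Type*} [DecidableEq ι] (k : ℕ) (N n : ι → ℕ)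
    (m : ι → Fin (k + 1) → ℕ) (t : ι) (ℓ : Fin (k + 1)) (g : ℕ) (τ : Finset ι) : ℝ :=
  (((m t ℓ).choose g * aCoeff k (m t) (n t) g ℓ : ℕ) : ℝ) / ((N t).choose (n t) : ℝ) *
    ∏ s ∈ τ.erase t, ((bCoeff k (m s) (n s) g : ℕ) : ℝ) / ((N s).choose (n s) : ℝ)

/-- `P(t, g | τ) = ∑_ℓ P(t, ℓ, g | τ)`. -/
noncomputable def Pmode {ι : Type*} [DecidableEq ι] (k : ℕ) (N n : ι → ℕ)
    (m : ι → Fin (k + 1) → ℕ) (t : ι) (g : ℕ) (τ : Finset ι) : ℝ :=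
  ∑ ℓ : Fin (k + 1), Pfun k N n m t ℓ g τ

/-- Minimal mode number `g₀(t) = max(⌈n t/(k+1)⌉, ⌈n t · m t 0 / N t⌉)`. -/
noncomputable def gZero {ι : Type*} (k : ℕ) (N n : ι → ℕ)
    (m : ι → Fin (k + 1) → ℕ) (t : ι) : ℕ :=
  max ⌈(n t : ℚ) / (k + 1)⌉₊ ⌈(n t * m t 0 : ℚ) / (N t : ℚ)⌉₊

/-- `Q_max(t, g, τ') = (max_ℓ C(m t ℓ, g)·a^t_{g,ℓ}/C(N t, n t))·∏_{s∈τ'} b^s_g/C(N s, n s)`. -/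
noncomputable def Qmax {ι : Type*} [DecidableEq ι] (k : ℕ) (N n : ι → ℕ)
    (m : ι → Fin (k + 1) → ℕ) (t : ι) (g : ℕ) (τ' : Finset ι) : ℝ :=
  (Finset.univ.sup' ⟨0, Finset.mem_univ 0⟩ fun ℓ : Fin (k + 1) =>
      (((m t ℓ).choose g * aCoeff k (m t) (n t) g ℓ : ℕ) : ℝ) / ((N t).choose (n t) : ℝ)) *
    ∏ s ∈ τ', ((bCoeff k (m s) (n s) g : ℕ) : ℝ) / ((N s).choose (n s) : ℝ)

/-- `Q_min`: the minimum over size-`d0` subsets `τ ⊆ [d1]` and `t ∈ τ` of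
`∑_{g=g₀(t)}^{n t} P(t, g | τ)`. -/
noncomputable def Qmin (d1 k d0 : ℕ) (N n : Fin d1 → ℕ) (m : Fin d1 → Fin (k + 1) → ℕ) : ℝ :=
  sInf {x : ℝ | ∃ τ ∈ Finset.powersetCard d0 (Finset.univ : Finset (Fin d1)), ∃ t ∈ τ,
    x = ∑ g ∈ Finset.Icc (gZero k N n m t) (n t), Pmode k N n m t g τ}

/-- `β_t = ∑_{τ' ⊆ [d1]\{t}, |τ'| = d0−1} ∑_{g=g₀(t)}^{n t} (1/C(d1, d0))·Q_max(t, g, τ')`. -/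
noncomputable def betaCoef (d1 k d0 : ℕ) (N n : Fin d1 → ℕ)
    (m : Fin d1 → Fin (k + 1) → ℕ) (t : Fin d1) : ℝ :=
  ∑ τ' ∈ Finset.powersetCard (d0 - 1) ((Finset.univ : Finset (Fin d1)).erase t),
    ∑ g ∈ Finset.Icc (gZero k N n m t) (n t), (1 / (d1.choose d0 : ℝ)) * Qmax k N n m t g τ'

/-- The smallest singular value of `M`: the largest `σ ≥ 0` with `‖My‖₂ ≥ σ‖y‖₂` for all `y`. -/
noncomputable def sigmaMin {d1 d2 : ℕ} (M : Matrix (Fin d1) (Fin d2) ℝ) : ℝ :=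
  sSup {σ : ℝ | 0 ≤ σ ∧ ∀ y : Fin d2 → ℝ,
    σ * Real.sqrt (∑ i, y i ^ 2) ≤ Real.sqrt (∑ i, (∑ j, M i j * y j) ^ 2)}

theorem coeff_catPoly_le (mc g i : ℕ) :
    (catPoly mc g).coeff i ≤ mc.choose i := by
  rw [catPoly, finsetSum_coeff]
  simp only [coeff_C_mul_X_pow, Finset.sum_ite_eq]
  split_ifs <;> simp

theorem coeff_prod_catPoly_le {κ : Type*} (s : Finset κ) (m : κ → ℕ) (g i : ℕ) :
    (∏ ℓ ∈ s, catPoly (m ℓ) g).coeff i ≤ (∑ ℓ ∈ s, m ℓ).choose i := by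
  classical
  induction s using Finset.induction_on generalizing i with
  | empty =>
    rw [Finset.prod_empty, Finset.sum_empty, coeff_one]
    cases i <;> simp
  | insert a s ha ih =>
    rw [Finset.prod_insert ha, Finset.sum_insert ha, coeff_mul, Nat.add_choose_eq]
    refine Finset.sum_le_sum fun p _ => Nat.mul_le_mul (coeff_catPoly_le _ _ _) (ih _)

theorem bCoeff_le_choose (k : ℕ) (m : Fin (k + 1) → ℕ) (n g : ℕ) :
    bCoeff k m n g ≤ (∑ ℓ, m ℓ).choose n :=
  coeff_prod_catPoly_le _ _ _ _

theorem sum_choose_mul_aCoeff_le (k : ℕ) (m : Fin (k + 1) → ℕ) (n : ℕ) (ℓ : Fin (k + 1)) :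
    ∑ g ∈ Finset.range (n + 1), (m ℓ).choose g * aCoeff k m n g ℓ ≤ (∑ ℓ, m ℓ).choose n := by
  rw [← Finset.add_sum_erase _ m (Finset.mem_univ ℓ), Nat.add_choose_eq,
    Finset.Nat.sum_antidiagonal_eq_sum_range_succ
      (fun a b => (m ℓ).choose a * (∑ x ∈ univ.erase ℓ, m x).choose b)]
  exact Finset.sum_le_sum fun g _ => Nat.mul_le_mul_left _ (coeff_prod_catPoly_le _ _ _ _)

theorem sum_Pfun_le_one {ι : Type*} [DecidableEq ι] (k : ℕ) (N n : ι → ℕ)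
    (m : ι → Fin (k + 1) → ℕ) (hmN : ∀ r, ∑ ℓ, m r ℓ = N r)
    (t : ι) (ℓ : Fin (k + 1)) (g₀ : ℕ) (τ : Finset ι) :
    ∑ g ∈ Finset.Icc g₀ (n t), Pfun k N n m t ℓ g τ ≤ 1 := by
  calc ∑ g ∈ Finset.Icc g₀ (n t), Pfun k N n m t ℓ g τ
      ≤ ∑ g ∈ Finset.Icc g₀ (n t),
          (((m t ℓ).choose g * aCoeff k (m t) (n t) g ℓ : ℕ) : ℝ) / ((N t).choose (n t) : ℝ) := by
        refine Finset.sum_le_sum fun g _ => mul_le_of_le_one_right (by positivity) ?_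
        refine Finset.prod_le_one (fun s _ => by positivity) fun s _ => ?_
        refine div_le_one_of_le₀ ?_ (Nat.cast_nonneg _)
        exact_mod_cast hmN s ▸ bCoeff_le_choose k (m s) (n s) g
    _ ≤ ∑ g ∈ Finset.range (n t + 1),
          (((m t ℓ).choose g * aCoeff k (m t) (n t) g ℓ : ℕ) : ℝ) / ((N t).choose (n t) : ℝ) := by
        refine Finset.sum_le_sum_of_subset_of_nonneg (fun g hg => ?_) fun g _ _ => by positivity
        rw [Finset.mem_Icc] at hg
        exact Finset.mem_range.2 (Nat.lt_succ_of_le hg.2)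
    _ ≤ 1 := by
        rw [← Finset.sum_div]
        refine div_le_one_of_le₀ ?_ (Nat.cast_nonneg _)
        exact_mod_cast hmN t ▸ sum_choose_mul_aCoeff_le k (m t) (n t) ℓ

theorem card_filter_mem_powersetCard {ι : Type*} [DecidableEq ι] (s : Finset ι) {t : ι}
    (ht : t ∈ s) (d : ℕ) :
    #{τ ∈ s.powersetCard (d + 1) | t ∈ τ} = (#s - 1).choose d := by
  simpa using Finset.card_filter_powersetCard_subset {t} s (d + 1)
    (Finset.singleton_subset_iff.2 ht) (by simp)

theorem sum_powersetCard_sum {ι : Type*} (s : Finset ι) (d : ℕ) (c : ι → ℝ) :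
    ∑ τ ∈ s.powersetCard (d + 1), ∑ t ∈ τ, c t = ((#s - 1).choose d : ℝ) * ∑ t ∈ s, c t := by
  classical
  rw [Finset.sum_comm' (t' := s) (s' := fun t => {τ ∈ s.powersetCard (d + 1) | t ∈ τ}),
    Finset.mul_sum]
  · refine Finset.sum_congr rfl fun t ht => ?_
    rw [Finset.sum_const, card_filter_mem_powersetCard s ht, nsmul_eq_mul]
  · intro τ t
    simp only [Finset.mem_filter, Finset.mem_powersetCard]
    exact ⟨fun h => ⟨h, h.1.1 h.2⟩, fun h => h.1⟩

/-- Crude bound for the expected squared adversarial error: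
`(1/C(d1,d0))·∑_τ ∑_{t∈τ} ∑_{g=g₀(t)}^{n t} ∑_{ℓ=0}^{k} P(t,ℓ,g|τ)·e_{t,ℓ}²/‖A_t‖₂²
  ≤ (d0/d1)·∑_{t∈[d1]} ‖ẽ_t‖₂²`, where `‖ẽ_t‖₂² = ∑_ℓ e_{t,ℓ}²/‖A_t‖₂²`. -/
theorem stmt_10 (d1 d2 k d0 : ℕ) (hd0 : 1 ≤ d0) (hd0' : d0 ≤ d1)
    (A : Matrix (Fin d1) (Fin d2) ℝ) (hA : ∀ t, ∑ j, A t j ^ 2 ≠ 0)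
    (N n : Fin d1 → ℕ) (m : Fin d1 → Fin (k + 1) → ℕ)
    (hnN : ∀ r, n r ≤ N r) (hmN : ∀ r, ∑ ℓ, m r ℓ = N r)
    (e : Fin d1 → Fin (k + 1) → ℝ) (he0 : ∀ t, e t 0 = 0) :
    (1 / (d1.choose d0 : ℝ)) *
        ∑ τ ∈ Finset.powersetCard d0 (Finset.univ : Finset (Fin d1)),
          ∑ t ∈ τ, ∑ g ∈ Finset.Icc (gZero k N n m t) (n t), ∑ ℓ : Fin (k + 1),
            Pfun k N n m t ℓ g τ * e t ℓ ^ 2 / (∑ j, A t j ^ 2)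
      ≤ ((d0 : ℝ) / (d1 : ℝ)) *
          ∑ t, ∑ ℓ : Fin (k + 1), e t ℓ ^ 2 / (∑ j, A t j ^ 2) := by
  obtain ⟨d, rfl⟩ : ∃ d, d0 = d + 1 := ⟨d0 - 1, by omega⟩
  obtain ⟨D, rfl⟩ : ∃ D, d1 = D + 1 := ⟨d1 - 1, by omega⟩
  have hrow (τ : Finset (Fin (D + 1))) (t : Fin (D + 1)) :
      ∑ g ∈ Finset.Icc (gZero k N n m t) (n t), ∑ ℓ : Fin (k + 1),
          Pfun k N n m t ℓ g τ * e t ℓ ^ 2 / (∑ j, A t j ^ 2)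
        ≤ ∑ ℓ : Fin (k + 1), e t ℓ ^ 2 / (∑ j, A t j ^ 2) := by
    rw [Finset.sum_comm]
    refine Finset.sum_le_sum fun ℓ _ => ?_
    simp only [mul_div_assoc]
    rw [← Finset.sum_mul]
    exact mul_le_of_le_one_left (by positivity) (sum_Pfun_le_one k N n m hmN t ℓ _ τ)
  have hchoose : (0 : ℝ) < ((D + 1).choose (d + 1) : ℝ) := by
    exact_mod_cast Nat.choose_pos hd0'
  have hratio : 1 / ((D + 1).choose (d + 1) : ℝ) * (D.choose d : ℝ)
      = ((d + 1 : ℕ) : ℝ) / ((D + 1 : ℕ) : ℝ) := by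
    have h : (((D + 1 : ℕ) : ℝ)) * D.choose d = (D + 1).choose (d + 1) * ((d + 1 : ℕ) : ℝ) := by
      exact_mod_cast Nat.add_one_mul_choose_eq D d
    field_simp
    linarith
  calc _ ≤ 1 / ((D + 1).choose (d + 1) : ℝ) *
        ∑ τ ∈ Finset.powersetCard (d + 1) (Finset.univ : Finset (Fin (D + 1))),
          ∑ t ∈ τ, ∑ ℓ : Fin (k + 1), e t ℓ ^ 2 / (∑ j, A t j ^ 2) := by
        gcongr with τ _ t _
        exact hrow τ t
    _ = _ := by
        rw [sum_powersetCard_sum, Finset.card_fin, Nat.add_sub_cancel, ← mul_assoc, hratio]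
end

section
/- Let A ∈ ℝ^{d1×d2} have nonzero rows, let x* satisfy A x* = b, fix the worker/category data, probabilities P(t, ℓ, g | τ), g_0(t), Q_min and β_t as in the context, let 1 ≤ d0 ≤ d1, and let e_{t,ℓ} ∈ ℝ with e_{t,0} = 0. For x ∈ ℝ^{d2} define the one-step expected squared error E(x) = (1 / C(d1, d0)) · Σ_{τ ⊆ [d1], |τ| = d0} [ (1 − Σ_{t∈τ} Σ_{g=g_0(t)}^{n_t} Σ_{ℓ=0}^{k} P(t, ℓ, g | τ)) · ‖x − x*‖₂² + Σ_{t∈τ} Σ_{g=g_0(t)}^{n_t} Σ_{ℓ=0}^{k} P(t, ℓ, g | τ) · ‖x − ((⟨A_t, x⟩ − (b_t + e_{t,ℓ})) / ‖A_t‖₂²) A_tᵀ − x*‖₂² ]. Then E(x) ≤ (1 − Q_min · (d0/d1) · σ_min(Ã)²) · ‖x − x*‖₂² + Σ_{t∈[d1]} β_t · ‖ẽ_t‖₂². -/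
open Finset Polynomial

/-- Pairs `(τ, t)` with `t ∈ τ`, `|τ| = d`, correspond to pairs `(t, τ \ {t})`. -/
theorem sum_powersetCard_sum_erase {ι M : Type*} [Fintype ι] [DecidableEq ι] [AddCommMonoid M]
    {d : ℕ} (hd : 1 ≤ d) (f : ι → Finset ι → M) :
    ∑ τ ∈ powersetCard d (univ : Finset ι), ∑ t ∈ τ, f t (τ.erase t) =
      ∑ t, ∑ τ' ∈ powersetCard (d - 1) (univ.erase t), f t τ' := by
  rw [Finset.sum_comm' (t' := univ) (s' := fun t => (powersetCard d univ).filter (t ∈ ·))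
    (by simp)]
  refine sum_congr rfl fun t _ => ?_
  refine sum_nbij' (fun τ => τ.erase t) (fun τ' => insert t τ') ?_ ?_ ?_ ?_ ?_
  · intro τ hτ
    simp only [mem_filter, mem_powersetCard] at hτ ⊢
    exact ⟨erase_subset_erase _ hτ.1.1, by rw [card_erase_of_mem hτ.2, hτ.1.2]⟩
  · intro τ' hτ'
    simp only [mem_filter, mem_powersetCard, subset_erase] at hτ' ⊢
    refine ⟨⟨subset_univ _, ?_⟩, mem_insert_self _ _⟩
    rw [card_insert_of_notMem hτ'.1.2]
    omega
  · intro τ hτ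
    exact insert_erase (mem_filter.1 hτ).2
  · intro τ' hτ'
    exact erase_insert (subset_erase.1 (mem_powersetCard.1 hτ').1).2
  · intros
    rfl

/-- A given point lies in a uniformly random `d`-subset with probability `d / |ι|`. -/
theorem average_powersetCard_sum {ι : Type*} [Fintype ι] [DecidableEq ι] {d : ℕ} (hd : 1 ≤ d)
    (hd' : d ≤ Fintype.card ι) (c : ι → ℝ) :
    1 / ((Fintype.card ι).choose d : ℝ) *
        ∑ τ ∈ powersetCard d (univ : Finset ι), ∑ t ∈ τ, c t =
      (d : ℝ) / Fintype.card ι * ∑ t, c t := by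
  rw [sum_powersetCard_sum_erase hd (fun t _ => c t)]
  simp only [sum_const, card_powersetCard, card_erase_of_mem (mem_univ _), card_univ,
    nsmul_eq_mul, ← mul_sum]
  rw [← mul_assoc]
  congr 1
  have hpos : (0 : ℝ) < (Fintype.card ι).choose d := by exact_mod_cast Nat.choose_pos hd'
  have hcard : (0 : ℝ) < Fintype.card ι := by exact_mod_cast hd.trans hd'
  obtain ⟨d, rfl⟩ := Nat.exists_eq_add_of_le' hd
  obtain ⟨q, hq⟩ := Nat.exists_eq_add_of_le' (hd.trans hd')
  rw [hq] at hpos hcard ⊢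
  have h : ((q + 1 : ℕ) : ℝ) * q.choose d = (q + 1).choose (d + 1) * (d + 1 : ℕ) := by
    exact_mod_cast Nat.add_one_mul_choose_eq q d
  simp only [Nat.add_sub_cancel]
  field_simp
  linarith

theorem sigmaMin_sq_mul_le {d1 d2 : ℕ} (M : Matrix (Fin d1) (Fin d2) ℝ) (y : Fin d2 → ℝ) :
    sigmaMin M ^ 2 * ∑ i, y i ^ 2 ≤ ∑ i, (∑ j, M i j * y j) ^ 2 := by
  have hy : 0 ≤ ∑ i, y i ^ 2 := sum_nonneg fun i _ => sq_nonneg _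
  have hM : 0 ≤ ∑ i, (∑ j, M i j * y j) ^ 2 := sum_nonneg fun i _ => sq_nonneg _
  rcases hy.eq_or_lt with h0 | hpos
  · rw [← h0, mul_zero]
    exact hM
  · have hs : 0 < Real.sqrt (∑ i, y i ^ 2) := Real.sqrt_pos.2 hpos
    have hle : sigmaMin M ≤
        Real.sqrt (∑ i, (∑ j, M i j * y j) ^ 2) / Real.sqrt (∑ i, y i ^ 2) :=
      csSup_le ⟨0, le_rfl, fun z => by rw [zero_mul]; exact Real.sqrt_nonneg _⟩
        fun σ hσ => (le_div_iff₀ hs).2 (hσ.2 y)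
    have h0 : 0 ≤ sigmaMin M := Real.sSup_nonneg fun σ hσ => hσ.1
    have h := pow_le_pow_left₀ (mul_nonneg h0 hs.le) ((le_div_iff₀ hs).1 hle) 2
    rwa [mul_pow, Real.sq_sqrt hy, Real.sq_sqrt hM] at h

section Probabilities

variable {ι : Type*} [DecidableEq ι] (k : ℕ) (N n : ι → ℕ) (m : ι → Fin (k + 1) → ℕ)

theorem Pfun_nonneg (t : ι) (ℓ : Fin (k + 1)) (g : ℕ) (τ : Finset ι) :
    0 ≤ Pfun k N n m t ℓ g τ :=
  mul_nonneg (by positivity) (prod_nonneg fun _ _ => by positivity)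

theorem Pfun_le_Qmax (t : ι) (ℓ : Fin (k + 1)) (g : ℕ) (τ : Finset ι) :
    Pfun k N n m t ℓ g τ ≤ Qmax k N n m t g (τ.erase t) :=
  mul_le_mul_of_nonneg_right
    (le_sup' (fun ℓ : Fin (k + 1) =>
      (((m t ℓ).choose g * aCoeff k (m t) (n t) g ℓ : ℕ) : ℝ) / ((N t).choose (n t) : ℝ))
      (mem_univ ℓ))
    (prod_nonneg fun _ _ => by positivity)

end Probabilities

theorem Qmin_nonneg (d1 k d0 : ℕ) (N n : Fin d1 → ℕ) (m : Fin d1 → Fin (k + 1) → ℕ) :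
    0 ≤ Qmin d1 k d0 N n m := by
  refine Real.sInf_nonneg ?_
  rintro _ ⟨τ, -, t, -, rfl⟩
  exact sum_nonneg fun g _ => sum_nonneg fun ℓ _ => Pfun_nonneg k N n m t ℓ g τ

theorem Qmin_le {d1 k d0 : ℕ} (N n : Fin d1 → ℕ) (m : Fin d1 → Fin (k + 1) → ℕ)
    {τ : Finset (Fin d1)} (hτ : τ ∈ powersetCard d0 univ) {t : Fin d1} (ht : t ∈ τ) :
    Qmin d1 k d0 N n m ≤
      ∑ g ∈ Icc (gZero k N n m t) (n t), ∑ ℓ : Fin (k + 1), Pfun k N n m t ℓ g τ := by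
  refine csInf_le ⟨0, ?_⟩ ⟨τ, hτ, t, ht, rfl⟩
  rintro _ ⟨τ, -, t, -, rfl⟩
  exact sum_nonneg fun g _ => sum_nonneg fun ℓ _ => Pfun_nonneg k N n m t ℓ g τ

/-- Squared error after one Kaczmarz step with right-hand side perturbed by `ε`. -/
theorem sum_sq_kaczmarz_step {κ : Type*} [Fintype κ] (a x z : κ → ℝ) {β : ℝ} (ε : ℝ)
    (ha : ∑ j, a j ^ 2 ≠ 0) (hz : ∑ j, a j * z j = β) :
    ∑ j, ((x j - ((∑ j', a j' * x j') - (β + ε)) / (∑ j', a j' ^ 2) * a j) - z j) ^ 2 =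
      ∑ j, (x j - z j) ^ 2 - (∑ j, a j * (x j - z j)) ^ 2 / (∑ j, a j ^ 2)
        + ε ^ 2 / (∑ j, a j ^ 2) := by
  have hr : (∑ j, a j * x j) - (β + ε) = (∑ j, a j * (x j - z j)) - ε := by
    simp only [mul_sub, sum_sub_distrib, hz]
    ring
  rw [hr]
  set r := ∑ j, a j * (x j - z j) with hrdef
  set S := ∑ j, a j ^ 2 with hS
  have hexp : ∀ c : ℝ, ∑ j, ((x j - c * a j) - z j) ^ 2 =
      ∑ j, (x j - z j) ^ 2 - 2 * c * r + c ^ 2 * S := by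
    intro c
    rw [hrdef, hS, mul_sum, mul_sum, ← sum_sub_distrib, ← sum_add_distrib]
    exact sum_congr rfl fun j _ => by ring
  rw [hexp]
  field_simp
  ring

/-- One-step expected squared-error bound for the distributed
randomized Kaczmarz method without block-list: the one-step expected squared error
`E(x)` (average over the uniformly chosen size-`d0` row subset `τ`, with the mode in
row `t`, category `ℓ`, mode number `g` occurring with probability `P(t,ℓ,g|τ)` and
no update otherwise) satisfies
`E(x) ≤ (1 − Q_min·(d0/d1)·σ_min(Ã)²)·‖x−x*‖₂² + ∑_t β_t·‖ẽ_t‖₂²`. -/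
theorem stmt_11 (d1 d2 k d0 : ℕ) (hd0 : 1 ≤ d0) (hd0' : d0 ≤ d1)
    (A : Matrix (Fin d1) (Fin d2) ℝ) (hA : ∀ t, ∑ j, A t j ^ 2 ≠ 0)
    (Atil : Matrix (Fin d1) (Fin d2) ℝ)
    (hAtil : ∀ t j, Atil t j = A t j / Real.sqrt (∑ j', A t j' ^ 2))
    (b : Fin d1 → ℝ) (xstar : Fin d2 → ℝ)
    (hsol : ∀ t, ∑ j, A t j * xstar j = b t)
    (N n : Fin d1 → ℕ) (m : Fin d1 → Fin (k + 1) → ℕ)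
    (hnN : ∀ r, n r ≤ N r) (hmN : ∀ r, ∑ ℓ, m r ℓ = N r)
    (e : Fin d1 → Fin (k + 1) → ℝ) (he0 : ∀ t, e t 0 = 0)
    (x : Fin d2 → ℝ) :
    (1 / (d1.choose d0 : ℝ)) *
        ∑ τ ∈ Finset.powersetCard d0 (Finset.univ : Finset (Fin d1)),
          ((1 - ∑ t ∈ τ, ∑ g ∈ Finset.Icc (gZero k N n m t) (n t), ∑ ℓ : Fin (k + 1),
                Pfun k N n m t ℓ g τ) * ∑ j, (x j - xstar j) ^ 2
            + ∑ t ∈ τ, ∑ g ∈ Finset.Icc (gZero k N n m t) (n t), ∑ ℓ : Fin (k + 1),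
                Pfun k N n m t ℓ g τ *
                  ∑ j, ((x j - ((∑ j', A t j' * x j') - (b t + e t ℓ)) / (∑ j', A t j' ^ 2)
                      * A t j) - xstar j) ^ 2)
      ≤ (1 - Qmin d1 k d0 N n m * ((d0 : ℝ) / (d1 : ℝ)) * sigmaMin Atil ^ 2) *
            ∑ j, (x j - xstar j) ^ 2
          + ∑ t, betaCoef d1 k d0 N n m t *
              (∑ ℓ : Fin (k + 1), e t ℓ ^ 2 / (∑ j, A t j ^ 2)) := by
  set D := ∑ j, (x j - xstar j) ^ 2
  set S : Fin d1 → ℝ := fun t => ∑ j, A t j ^ 2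
  set ρ : Fin d1 → ℝ := fun t => (∑ j, A t j * (x j - xstar j)) ^ 2 / S t
  set Q := Qmin d1 k d0 N n m
  set I : Fin d1 → Finset ℕ := fun t => Finset.Icc (gZero k N n m t) (n t)
  have hS0 : ∀ t, 0 ≤ S t := fun t => sum_nonneg fun j _ => sq_nonneg _
  have hρ0 : ∀ t, 0 ≤ ρ t := fun t => div_nonneg (sq_nonneg _) (hS0 t)
  have hchoose : (0 : ℝ) < d1.choose d0 := by exact_mod_cast Nat.choose_pos hd0'
  have hterm : ∀ τ ∈ powersetCard d0 (univ : Finset (Fin d1)),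
      ((1 - ∑ t ∈ τ, ∑ g ∈ I t, ∑ ℓ : Fin (k + 1), Pfun k N n m t ℓ g τ) * D
        + ∑ t ∈ τ, ∑ g ∈ I t, ∑ ℓ : Fin (k + 1), Pfun k N n m t ℓ g τ *
            ∑ j, ((x j - ((∑ j', A t j' * x j') - (b t + e t ℓ)) / (∑ j', A t j' ^ 2)
              * A t j) - xstar j) ^ 2)
      ≤ D - Q * ∑ t ∈ τ, ρ t + ∑ t ∈ τ, ∑ g ∈ I t, Qmax k N n m t g (τ.erase t) *
            ∑ ℓ : Fin (k + 1), e t ℓ ^ 2 / S t := by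
    intro τ hτ
    have hrow : ∀ t ∈ τ,
        (∑ g ∈ I t, ∑ ℓ : Fin (k + 1), Pfun k N n m t ℓ g τ *
            ∑ j, ((x j - ((∑ j', A t j' * x j') - (b t + e t ℓ)) / (∑ j', A t j' ^ 2)
              * A t j) - xstar j) ^ 2)
        ≤ (∑ g ∈ I t, ∑ ℓ : Fin (k + 1), Pfun k N n m t ℓ g τ) * D - Q * ρ t
          + ∑ g ∈ I t, Qmax k N n m t g (τ.erase t) *
            ∑ ℓ : Fin (k + 1), e t ℓ ^ 2 / S t := by
      intro t ht
      have hsplit : (∑ g ∈ I t, ∑ ℓ : Fin (k + 1), Pfun k N n m t ℓ g τ *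
            ∑ j, ((x j - ((∑ j', A t j' * x j') - (b t + e t ℓ)) / (∑ j', A t j' ^ 2)
              * A t j) - xstar j) ^ 2)
          = (∑ g ∈ I t, ∑ ℓ : Fin (k + 1), Pfun k N n m t ℓ g τ) * (D - ρ t)
            + ∑ g ∈ I t, ∑ ℓ : Fin (k + 1), Pfun k N n m t ℓ g τ * (e t ℓ ^ 2 / S t) := by
        simp only [sum_mul, ← sum_add_distrib, ← mul_add]
        refine sum_congr rfl fun g _ => sum_congr rfl fun ℓ _ => ?_
        rw [sum_sq_kaczmarz_step (A t) x xstar (e t ℓ) (hA t) (hsol t)]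
      have herr : (∑ g ∈ I t, ∑ ℓ : Fin (k + 1), Pfun k N n m t ℓ g τ * (e t ℓ ^ 2 / S t))
          ≤ ∑ g ∈ I t, Qmax k N n m t g (τ.erase t) *
            ∑ ℓ : Fin (k + 1), e t ℓ ^ 2 / S t := by
        simp only [mul_sum]
        exact sum_le_sum fun g _ => sum_le_sum fun ℓ _ =>
          mul_le_mul_of_nonneg_right (Pfun_le_Qmax k N n m t ℓ g τ)
            (div_nonneg (sq_nonneg _) (hS0 t))
      have hgain := mul_le_mul_of_nonneg_right (Qmin_le N n m hτ ht) (hρ0 t)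
      rw [hsplit]
      linarith
    have h := sum_le_sum hrow
    rw [sum_add_distrib, sum_sub_distrib, ← sum_mul, ← mul_sum] at h
    linarith
  have hcontr : Q * ((d0 : ℝ) / d1) * sigmaMin Atil ^ 2 * D ≤
      Q * ((d0 : ℝ) / d1 * ∑ t, ρ t) := by
    have hσ := sigmaMin_sq_mul_le Atil (fun j => x j - xstar j)
    have hAρ : ∀ t, (∑ j, Atil t j * (x j - xstar j)) ^ 2 = ρ t := by
      intro t
      simp only [hAtil, div_mul_eq_mul_div, ← sum_div, div_pow]
      rw [Real.sq_sqrt (hS0 t)]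
    simp only [hAρ] at hσ
    have := mul_le_mul_of_nonneg_left hσ
      (mul_nonneg (Qmin_nonneg d1 k d0 N n m) (by positivity : (0 : ℝ) ≤ (d0 : ℝ) / d1))
    linarith
  have hbeta : 1 / (d1.choose d0 : ℝ) * ∑ τ ∈ powersetCard d0 (univ : Finset (Fin d1)),
      ∑ t ∈ τ, ∑ g ∈ I t, Qmax k N n m t g (τ.erase t) * ∑ ℓ : Fin (k + 1), e t ℓ ^ 2 / S t
      = ∑ t, betaCoef d1 k d0 N n m t * ∑ ℓ : Fin (k + 1), e t ℓ ^ 2 / S t := by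
    rw [sum_powersetCard_sum_erase hd0 (fun t τ' => ∑ g ∈ I t, Qmax k N n m t g τ' *
      ∑ ℓ : Fin (k + 1), e t ℓ ^ 2 / S t), mul_sum]
    refine sum_congr rfl fun t _ => ?_
    simp only [betaCoef, ← sum_mul, ← mul_sum]
    ring
  have havg := average_powersetCard_sum hd0 (hd0'.trans_eq (Fintype.card_fin d1).symm) ρ
  rw [Fintype.card_fin] at havg
  have hone : 1 / (d1.choose d0 : ℝ) * ((d1.choose d0 : ℝ) * D) = D := by
    field_simp
  calc _ ≤ 1 / (d1.choose d0 : ℝ) * ∑ τ ∈ powersetCard d0 (univ : Finset (Fin d1)),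
        (D - Q * ∑ t ∈ τ, ρ t + ∑ t ∈ τ, ∑ g ∈ I t, Qmax k N n m t g (τ.erase t) *
            ∑ ℓ : Fin (k + 1), e t ℓ ^ 2 / S t) :=
        mul_le_mul_of_nonneg_left (sum_le_sum hterm) (by positivity)
    _ = D - Q * ((d0 : ℝ) / d1 * ∑ t, ρ t)
        + ∑ t, betaCoef d1 k d0 N n m t * ∑ ℓ : Fin (k + 1), e t ℓ ^ 2 / S t := by
        rw [sum_add_distrib, sum_sub_distrib, mul_add, mul_sub, hbeta, ← mul_sum, sum_const,
          card_powersetCard, card_univ, Fintype.card_fin, nsmul_eq_mul, hone, ← havg]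
        ring
    _ ≤ _ := by linarith
end
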